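/- Let ξ be a nonnegative random variable with E[ξ]=1, positive variance, and finite third moment. Define F(p,h) := E[√(1 + p(e^h ξ − 1))] for p ∈ [0,1], h ≥ 0, and let p_h be a maximizer of p ↦ F(p,h). Then as h → 0+, p_h ∼ 2h/Var(ξ) and max_{p∈[0,1]} F(p,h) − 1 = h^2/(2 Var(ξ)) + O(h^3). -/

import Mathlib

open MeasureTheory Filter

theorem abs_sqrt_one_add_sub_taylor_le {u : ℝ} (hu : -1 ≤ u) :
    |Real.sqrt (1 + u) - (1 + u / 2 - u ^ 2 / 8)| ≤ 3 / 8 * |u| ^ 3 := by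
  obtain ⟨s, hs, rfl⟩ : ∃ s : ℝ, 0 ≤ s ∧ u = s ^ 2 - 1 :=
    ⟨Real.sqrt (1 + u), Real.sqrt_nonneg _, by rw [Real.sq_sqrt (by linarith)]; ring⟩
  rw [show 1 + (s ^ 2 - 1) = s ^ 2 by ring, Real.sqrt_sq hs,
    show s - (1 + (s ^ 2 - 1) / 2 - (s ^ 2 - 1) ^ 2 / 8) = (s - 1) ^ 3 * ((s + 3) / 8) by ring,
    show s ^ 2 - 1 = (s - 1) * (s + 1) by ring, abs_mul, abs_mul, abs_pow,
    abs_of_nonneg (by positivity : 0 ≤ (s + 3) / 8), abs_of_nonneg (by positivity : 0 ≤ s + 1),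
    mul_pow]
  have h : (s + 3) / 8 ≤ 3 / 8 * (s + 1) ^ 3 := by
    nlinarith [pow_nonneg hs 2, pow_nonneg hs 3]
  calc |s - 1| ^ 3 * ((s + 3) / 8) ≤ |s - 1| ^ 3 * (3 / 8 * (s + 1) ^ 3) := by gcongr
    _ = _ := by ring

theorem sqrt_one_add_le_sub_sq {u x : ℝ} (hu : -1 ≤ u) (hux : u ≤ x) (c : ℝ) :
    Real.sqrt (1 + u) ≤ 1 + u / 2 - u ^ 2 / 4 * (2 * c - c ^ 2 * (2 + x)) := by
  obtain ⟨s, hs, rfl⟩ : ∃ s : ℝ, 0 ≤ s ∧ u = s ^ 2 - 1 :=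
    ⟨Real.sqrt (1 + u), Real.sqrt_nonneg _, by rw [Real.sq_sqrt (by linarith)]; ring⟩
  rw [show 1 + (s ^ 2 - 1) = s ^ 2 by ring, Real.sqrt_sq hs]
  have h : (s + 1) ^ 2 * (2 * c - c ^ 2 * (2 + x)) ≤ 2 := by
    have h1 : (s + 1) ^ 2 ≤ 2 * (2 + x) := by nlinarith [sq_nonneg (s - 1)]
    nlinarith [sq_nonneg ((s + 1) ^ 2 * c - 2),
      mul_le_mul_of_nonneg_left h1 (by positivity : 0 ≤ (s + 1) ^ 2 * c ^ 2)]
  nlinarith [mul_le_mul_of_nonneg_left h (sq_nonneg (s - 1))]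

section Expectation

variable {Ω : Type*} [MeasurableSpace Ω] {μ : Measure Ω} [IsProbabilityMeasure μ] {X : Ω → ℝ}
  {p : ℝ}

theorem integrable_sqrt_one_add_mul (hX : Integrable X μ) (p : ℝ) :
    Integrable (fun ω => Real.sqrt (1 + p * X ω)) μ := by
  have hi : Integrable (fun ω => 1 + p * X ω) μ := (integrable_const 1).add (hX.const_mul p)
  refine ((integrable_const (1 : ℝ)).add hi.abs).mono'
    (Real.continuous_sqrt.comp_aestronglyMeasurable hi.aestronglyMeasurable) ?_
  filter_upwards with ω
  rw [Real.norm_of_nonneg (Real.sqrt_nonneg _)]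
  refine Real.sqrt_le_iff.2 ⟨by simp only [Pi.add_apply]; positivity, ?_⟩
  simp only [Pi.add_apply]
  nlinarith [le_abs_self (1 + p * X ω), abs_nonneg (1 + p * X ω)]

theorem integral_quadratic (hX : Integrable X μ) (hX2 : Integrable (fun ω => X ω ^ 2) μ)
    (a b : ℝ) :
    Integrable (fun ω => 1 + a * X ω + b * X ω ^ 2) μ ∧
    ∫ ω, (1 + a * X ω + b * X ω ^ 2) ∂μ = 1 + a * ∫ ω, X ω ∂μ + b * ∫ ω, X ω ^ 2 ∂μ := by
  have h1 : Integrable (fun ω => 1 + a * X ω) μ := (integrable_const 1).add (hX.const_mul a)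
  refine ⟨h1.add (hX2.const_mul b), ?_⟩
  rw [integral_add h1 (hX2.const_mul b), integral_add (integrable_const 1) (hX.const_mul a),
    integral_const_mul, integral_const_mul]
  simp

theorem neg_one_le_mul {p x : ℝ} (hp : p ∈ Set.Icc (0 : ℝ) 1) (hx : -1 ≤ x) : -1 ≤ p * x := by
  nlinarith [hp.1, hp.2]

theorem abs_integral_sqrt_one_add_mul_sub_le (hX : Integrable X μ)
    (hX2 : Integrable (fun ω => X ω ^ 2) μ) (hX3 : Integrable (fun ω => |X ω| ^ 3) μ)
    (hlow : ∀ᵐ ω ∂μ, -1 ≤ X ω) (hp : p ∈ Set.Icc (0 : ℝ) 1) :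
    |∫ ω, Real.sqrt (1 + p * X ω) ∂μ -
        (1 + p / 2 * ∫ ω, X ω ∂μ + -(p ^ 2 / 8) * ∫ ω, X ω ^ 2 ∂μ)| ≤
      3 / 8 * p ^ 3 * ∫ ω, |X ω| ^ 3 ∂μ := by
  obtain ⟨hi, he⟩ := integral_quadratic hX hX2 (p / 2) (-(p ^ 2 / 8))
  rw [← he, ← integral_sub (integrable_sqrt_one_add_mul hX p) hi, ← integral_const_mul]
  rw [← Real.norm_eq_abs]
  refine norm_integral_le_of_norm_le (hX3.const_mul _) ?_
  filter_upwards [hlow] with ω hω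
  have h := abs_sqrt_one_add_sub_taylor_le (neg_one_le_mul hp hω)
  rw [abs_mul, abs_of_nonneg hp.1] at h
  rw [Real.norm_eq_abs]
  calc _ = |Real.sqrt (1 + p * X ω) - (1 + p * X ω / 2 - (p * X ω) ^ 2 / 8)| := by
        congr 1; ring
    _ ≤ _ := h
    _ = _ := by ring

theorem integral_sqrt_one_add_mul_le (hX : Integrable X μ)
    (hX2 : Integrable (fun ω => X ω ^ 2) μ) (hX3 : Integrable (fun ω => |X ω| ^ 3) μ)
    (hlow : ∀ᵐ ω ∂μ, -1 ≤ X ω) (hp : p ∈ Set.Icc (0 : ℝ) 1) (c : ℝ) :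
    ∫ ω, Real.sqrt (1 + p * X ω) ∂μ ≤
      1 + p / 2 * ∫ ω, X ω ∂μ + -(p ^ 2 / 4 * (2 * c - 2 * c ^ 2)) * ∫ ω, X ω ^ 2 ∂μ +
        p ^ 2 / 4 * c ^ 2 * ∫ ω, |X ω| ^ 3 ∂μ := by
  obtain ⟨hi, he⟩ := integral_quadratic hX hX2 (p / 2) (-(p ^ 2 / 4 * (2 * c - 2 * c ^ 2)))
  rw [← he, ← integral_const_mul, ← integral_add hi (hX3.const_mul _)]
  refine integral_mono_ae (integrable_sqrt_one_add_mul hX p) (hi.add (hX3.const_mul _)) ?_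
  filter_upwards [hlow] with ω hω
  have hux : p * X ω ≤ |X ω| :=
    (mul_le_mul_of_nonneg_left (le_abs_self _) hp.1).trans
      (mul_le_of_le_one_left (abs_nonneg _) hp.2)
  refine (sqrt_one_add_le_sub_sq (neg_one_le_mul hp hω) hux c).trans (le_of_eq ?_)
  rw [show |X ω| ^ 3 = |X ω| ^ 2 * |X ω| by ring, sq_abs]
  ring

end Expectation

theorem exp_bounds_of_mem_Ioc {h : ℝ} (hh : h ∈ Set.Ioc (0 : ℝ) 1) :
    h ≤ Real.exp h - 1 ∧ Real.exp h - 1 ≤ h + h ^ 2 ∧ Real.exp h - 1 ≤ 2 * h := by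
  have h1 := Real.add_one_le_exp h
  have h2 := (abs_le.1 (Real.abs_exp_sub_one_sub_id_le (x := h)
    (by rw [abs_of_pos hh.1]; exact hh.2))).2
  refine ⟨by linarith, by linarith, by nlinarith [hh.1, hh.2]⟩

theorem moments_exp_mul_sub_one {Ω : Type*} [MeasurableSpace Ω] {μ : Measure Ω}
    [IsProbabilityMeasure μ] {ξ : Ω → ℝ} (hint : Integrable ξ μ) (hmean : ∫ ω, ξ ω ∂μ = 1)
    (h2 : Integrable (fun ω => (ξ ω - 1) ^ 2) μ) (h3 : Integrable (fun ω => |ξ ω - 1| ^ 3) μ)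
    {h : ℝ} (hh : h ∈ Set.Ioc (0 : ℝ) 1) :
    Integrable (fun ω => Real.exp h * ξ ω - 1) μ ∧
    Integrable (fun ω => (Real.exp h * ξ ω - 1) ^ 2) μ ∧
    Integrable (fun ω => |Real.exp h * ξ ω - 1| ^ 3) μ ∧
    ∫ ω, (Real.exp h * ξ ω - 1) ∂μ = Real.exp h - 1 ∧
    ∫ ω, (Real.exp h * ξ ω - 1) ^ 2 ∂μ =
      Real.exp h ^ 2 * ∫ ω, (ξ ω - 1) ^ 2 ∂μ + (Real.exp h - 1) ^ 2 ∧
    ∫ ω, |Real.exp h * ξ ω - 1| ^ 3 ∂μ ≤ 108 * ∫ ω, |ξ ω - 1| ^ 3 ∂μ + 32 := by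
  obtain ⟨hb0, -, hb2⟩ := exp_bounds_of_mem_Ioc hh
  set a := Real.exp h
  have hX : Integrable (fun ω => a * ξ ω - 1) μ := (hint.const_mul a).sub (integrable_const 1)
  have hsq : (fun ω => (a * ξ ω - 1) ^ 2) = fun ω => a ^ 2 * (ξ ω - 1) ^ 2 +
      (2 * a * (a - 1) * ξ ω + ((a - 1) ^ 2 - 2 * a * (a - 1))) := by
    ext ω; ring
  have hi1 := h2.const_mul (a ^ 2)
  have hi2 := hint.const_mul (2 * a * (a - 1))
  have hi3 : Integrable (fun _ : Ω => (a - 1) ^ 2 - 2 * a * (a - 1)) μ := integrable_const _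
  have hi23 : Integrable
      (fun ω => 2 * a * (a - 1) * ξ ω + ((a - 1) ^ 2 - 2 * a * (a - 1))) μ := hi2.add hi3
  have hcube : ∀ ω, |a * ξ ω - 1| ^ 3 ≤ 108 * |ξ ω - 1| ^ 3 + 32 := by
    intro ω
    have hle : |a * ξ ω - 1| ≤ 3 * |ξ ω - 1| + 2 := by
      calc |a * ξ ω - 1| = |a * (ξ ω - 1) + (a - 1)| := by congr 1; ring
        _ ≤ |a * (ξ ω - 1)| + |a - 1| := abs_add_le _ _
        _ = a * |ξ ω - 1| + (a - 1) := by
          rw [abs_mul, abs_of_nonneg (by linarith [hh.1] : 0 ≤ a),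
            abs_of_nonneg (by linarith [hh.1] : 0 ≤ a - 1)]
        _ ≤ _ := by nlinarith [abs_nonneg (ξ ω - 1), hh.2]
    calc |a * ξ ω - 1| ^ 3 ≤ (3 * |ξ ω - 1| + 2) ^ 3 := by gcongr
      _ ≤ 4 * ((3 * |ξ ω - 1|) ^ 3 + 2 ^ 3) := by
        nlinarith [mul_nonneg (by positivity : 0 ≤ 3 * |ξ ω - 1| + 2)
          (sq_nonneg (3 * |ξ ω - 1| - 2))]
      _ = _ := by ring
  have hd : Integrable (fun ω => 108 * |ξ ω - 1| ^ 3 + 32) μ :=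
    (h3.const_mul 108).add (integrable_const 32)
  have hX3 : Integrable (fun ω => |a * ξ ω - 1| ^ 3) μ := by
    refine hd.mono' (hX.abs.aestronglyMeasurable.pow 3) ?_
    filter_upwards with ω
    rw [Real.norm_of_nonneg (by positivity)]
    exact hcube ω
  refine ⟨hX, ?_, hX3, ?_, ?_, ?_⟩
  · rw [hsq]; exact hi1.add hi23
  · rw [integral_sub (hint.const_mul a) (integrable_const 1), integral_const_mul, hmean]
    simp
  · rw [hsq, integral_add hi1 hi23, integral_add hi2 hi3, integral_const_mul,
      integral_const_mul, hmean]
    simp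
  · refine (integral_mono hX3 hd hcube).trans (le_of_eq ?_)
    rw [integral_add (h3.const_mul 108) (integrable_const 32), integral_const_mul]
    simp

/-- If `F p h - 1` is close to `p h / 2 - p² v / 8` and is dominated by a concave quadratic, then
its maximum over `p ∈ [0, 1]` and the maximizer are close to those of the quadratic. -/
theorem max_asymptotics_of_quadratic_approx {F : ℝ → ℝ → ℝ} {v K w : ℝ} (hv : 0 < v) (hK : 0 < K)
    (hw : 0 < w)
    (happ : ∀ h ∈ Set.Ioc (0 : ℝ) 1, ∀ p ∈ Set.Icc (0 : ℝ) 1,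
      |F p h - 1 - (p * h / 2 - p ^ 2 * v / 8)| ≤ K * (p * h ^ 2 + p ^ 2 * h + p ^ 3))
    (hup : ∀ h ∈ Set.Ioc (0 : ℝ) 1, ∀ p ∈ Set.Icc (0 : ℝ) 1, F p h - 1 ≤ p * h - w * p ^ 2)
    {ph : ℝ → ℝ}
    (hph : ∀ h : ℝ, 0 < h →
      ph h ∈ Set.Icc (0 : ℝ) 1 ∧ ∀ q ∈ Set.Icc (0 : ℝ) 1, F q h ≤ F (ph h) h) :
    Tendsto (fun h => ph h / (2 * h / v)) (nhdsWithin 0 (Set.Ioi 0)) (nhds 1) ∧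
      ∃ C : ℝ, 0 < C ∧ ∀ h ∈ Set.Ioc (0 : ℝ) 1, |F (ph h) h - 1 - h ^ 2 / (2 * v)| ≤ C * h ^ 3 := by
  have herr : ∀ A : ℝ, 0 ≤ A → ∀ h ∈ Set.Ioc (0 : ℝ) 1, ∀ p ∈ Set.Icc (0 : ℝ) 1, p ≤ A * h →
      |F p h - 1 - (h ^ 2 / (2 * v) - v / 8 * (p - 2 * h / v) ^ 2)| ≤
        K * (A + A ^ 2 + A ^ 3) * h ^ 3 := by
    intro A hA h hh p hp hpA
    have hh0 := hh.1.le
    have hp0 := hp.1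
    calc _ = |F p h - 1 - (p * h / 2 - p ^ 2 * v / 8)| := by
          congr 1; field_simp; ring
      _ ≤ K * (p * h ^ 2 + p ^ 2 * h + p ^ 3) := happ h hh p hp
      _ ≤ K * ((A * h) * h ^ 2 + (A * h) ^ 2 * h + (A * h) ^ 3) := by gcongr
      _ = _ := by ring
  have hone : ∀ h ∈ Set.Ioc (0 : ℝ) 1, 1 ≤ F (ph h) h := by
    intro h hh
    have h0 := happ h hh 0 (by simp)
    have hF0 : F 0 h - 1 = 0 := by
      rw [← abs_nonpos_iff]; simpa using h0
    linarith [(hph h hh.1).2 0 (by simp)]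
  have hsmall : ∀ h ∈ Set.Ioc (0 : ℝ) 1, ph h ≤ 1 / w * h := by
    intro h hh
    obtain ⟨hp, -⟩ := hph h hh.1
    have h1 := hup h hh _ hp
    have h2 := hone h hh
    rcases hp.1.eq_or_lt with h0 | h0
    · rw [← h0]; have := hh.1; positivity
    · rw [one_div, inv_mul_eq_div, le_div_iff₀ hw]
      refine le_of_mul_le_mul_left ?_ h0
      nlinarith
  set C₁ := K * (1 / w + (1 / w) ^ 2 + (1 / w) ^ 3) with hC₁
  set C₂ := K * (2 / v + (2 / v) ^ 2 + (2 / v) ^ 3) with hC₂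
  have hC₁0 : 0 < C₁ := by positivity
  have hC₂0 : 0 < C₂ := by positivity
  have hupper : ∀ h ∈ Set.Ioc (0 : ℝ) 1,
      F (ph h) h - 1 - h ^ 2 / (2 * v) ≤ C₁ * h ^ 3 - v / 8 * (ph h - 2 * h / v) ^ 2 := by
    intro h hh
    have := (abs_le.1 (herr (1 / w) (by positivity) h hh _ (hph h hh.1).1 (hsmall h hh))).2
    linarith
  have hlower : ∀ h ∈ Set.Ioc (0 : ℝ) 1, h ≤ v / 2 →
      -(C₂ * h ^ 3) ≤ F (ph h) h - 1 - h ^ 2 / (2 * v) := by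
    intro h hh hhv
    have hq : 2 * h / v ∈ Set.Icc (0 : ℝ) 1 :=
      ⟨by have := hh.1; positivity, by rw [div_le_one hv]; linarith⟩
    have h1 := (abs_le.1 (herr (2 / v) (by positivity) h hh _ hq (le_of_eq (by ring)))).1
    rw [sub_self] at h1
    linarith [(hph h hh.1).2 _ hq]
  constructor
  · rw [tendsto_iff_norm_sub_tendsto_zero]
    have hlim : Tendsto (fun h : ℝ => Real.sqrt (2 * v * (C₁ + C₂) * h))
        (nhdsWithin 0 (Set.Ioi 0)) (nhds 0) := by
      have hc : Continuous fun h : ℝ => Real.sqrt (2 * v * (C₁ + C₂) * h) := by fun_prop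
      simpa using (hc.tendsto 0).mono_left nhdsWithin_le_nhds
    refine squeeze_zero' (Eventually.of_forall fun _ => norm_nonneg _) ?_ hlim
    have hm : 0 < min 1 (v / 2) := by positivity
    filter_upwards [Ioc_mem_nhdsGT hm] with h hh
    have hh0 := hh.1
    have hh1 : h ∈ Set.Ioc (0 : ℝ) 1 := ⟨hh.1, hh.2.trans (min_le_left _ _)⟩
    have hb : v / 8 * (ph h - 2 * h / v) ^ 2 ≤ (C₁ + C₂) * h ^ 3 := by
      linarith [hupper h hh1, hlower h hh1 (hh.2.trans (min_le_right _ _))]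
    rw [Real.norm_eq_abs]
    refine Real.abs_le_sqrt ?_
    have he : (ph h / (2 * h / v) - 1) ^ 2 =
        (v / 8 * (ph h - 2 * h / v) ^ 2) * (2 * v / h ^ 2) := by
      field_simp; ring
    rw [he]
    calc _ ≤ (C₁ + C₂) * h ^ 3 * (2 * v / h ^ 2) := by gcongr
      _ = _ := by field_simp
  · refine ⟨C₁ + C₂ + 1 / v ^ 2, by positivity, fun h hh => ?_⟩
    have hh0 := hh.1
    have hh3 : 0 < h ^ 3 := by positivity
    have t1 : 0 < C₁ * h ^ 3 := by positivity
    have t2 : 0 < C₂ * h ^ 3 := by positivity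
    have t3 : 0 < 1 / v ^ 2 * h ^ 3 := by positivity
    rw [abs_le, add_mul, add_mul]
    refine ⟨?_, ?_⟩
    · rcases le_total h (v / 2) with hhv | hhv
      · linarith [hlower h hh hhv]
      · have h1 : h ^ 2 / (2 * v) ≤ 1 / v ^ 2 * h ^ 3 := by
          rw [← sub_nonneg, show 1 / v ^ 2 * h ^ 3 - h ^ 2 / (2 * v) =
            h ^ 2 / v ^ 2 * (h - v / 2) by field_simp]
          exact mul_nonneg (by positivity) (sub_nonneg.2 hhv)
        linarith [hone h hh]
    · have := hupper h hh
      have : 0 ≤ v / 8 * (ph h - 2 * h / v) ^ 2 := by positivity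
      linarith

/-- Asymptotics of the maximizer `p_h` and of the maximum of
`p ↦ E[√(1 + p(e^h ξ − 1))]` as `h → 0+`. -/
theorem sqrt_functional_max_asymptotics
    {Ω : Type*} [MeasurableSpace Ω] (μ : Measure Ω) [IsProbabilityMeasure μ]
    (ξ : Ω → ℝ) (hmeas : Measurable ξ)
    (hpos : ∀ᵐ ω ∂μ, 0 ≤ ξ ω)
    (hint : Integrable ξ μ) (hmean : ∫ ω, ξ ω ∂μ = 1)
    (h2 : Integrable (fun ω => (ξ ω - 1)^2) μ)
    (h3 : Integrable (fun ω => |ξ ω - 1|^3) μ)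
    (hvar : 0 < ∫ ω, (ξ ω - 1)^2 ∂μ)
    (F : ℝ → ℝ → ℝ)
    (hF : ∀ p h, F p h = ∫ ω, Real.sqrt (1 + p * (Real.exp h * ξ ω - 1)) ∂μ)
    (ph : ℝ → ℝ)
    (hph : ∀ h : ℝ, 0 < h →
      ph h ∈ Set.Icc (0:ℝ) 1 ∧ ∀ q ∈ Set.Icc (0:ℝ) 1, F q h ≤ F (ph h) h) :
    Tendsto (fun h => ph h / (2 * h / (∫ ω, (ξ ω - 1)^2 ∂μ)))
        (nhdsWithin 0 (Set.Ioi 0)) (nhds 1) ∧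
      ∃ C : ℝ, 0 < C ∧ ∀ h ∈ Set.Ioc (0:ℝ) 1,
        |F (ph h) h - 1 - h^2 / (2 * ∫ ω, (ξ ω - 1)^2 ∂μ)| ≤ C * h^3 := by
  set v := ∫ ω, (ξ ω - 1)^2 ∂μ with hv
  have hM0 : 0 ≤ ∫ ω, |ξ ω - 1| ^ 3 ∂μ := integral_nonneg fun ω => by positivity
  set M := 108 * ∫ ω, |ξ ω - 1| ^ 3 ∂μ + 32 with hM
  have hMpos : 0 < M := by positivity
  have hlow : ∀ h : ℝ, ∀ᵐ ω ∂μ, -1 ≤ Real.exp h * ξ ω - 1 := fun h => by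
    filter_upwards [hpos] with ω hω
    have := mul_nonneg (Real.exp_pos h).le hω
    linarith
  refine max_asymptotics_of_quadratic_approx (K := 1 + v + 3 / 8 * M)
    (w := 1 / 4 * (v ^ 2 / (2 * v + M))) hvar (by positivity) (by positivity) ?_ ?_ hph
  · intro h hh p hp
    obtain ⟨hb0, hb1, hb2⟩ := exp_bounds_of_mem_Ioc hh
    obtain ⟨i1, i2, i3, e1, e2, e3⟩ := moments_exp_mul_sub_one hint hmean h2 h3 hh
    have key := abs_integral_sqrt_one_add_mul_sub_le i1 i2 i3 (hlow h) hp
    rw [← hF, e1, e2, ← hv] at key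
    have hp0 := hp.1
    have hh0 := hh.1
    have k3 : 3 / 8 * p ^ 3 * ∫ ω, |Real.exp h * ξ ω - 1| ^ 3 ∂μ ≤ 3 / 8 * p ^ 3 * M := by
      gcongr
    have k1 : 0 ≤ p * (Real.exp h - 1 - h) ∧ p * (Real.exp h - 1 - h) ≤ p * h ^ 2 :=
      ⟨mul_nonneg hp0 (by linarith), by gcongr; linarith⟩
    have hD : 0 ≤ Real.exp h ^ 2 - 1 ∧ Real.exp h ^ 2 - 1 ≤ 8 * h := by
      constructor <;> nlinarith [hh.2]
    have hB : (Real.exp h - 1) ^ 2 ≤ 4 * h := by nlinarith [hh.2]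
    have k2 : 0 ≤ p ^ 2 * ((Real.exp h ^ 2 - 1) * v + (Real.exp h - 1) ^ 2) ∧
        p ^ 2 * ((Real.exp h ^ 2 - 1) * v + (Real.exp h - 1) ^ 2) ≤
          p ^ 2 * (8 * h * v + 4 * h) := by
      have := hD.1
      have := hD.2
      exact ⟨by positivity, by gcongr⟩
    have n1 : 0 ≤ p * h ^ 2 := by positivity
    have n2 : 0 ≤ p ^ 2 * h := by positivity
    have n3 : 0 ≤ p ^ 3 := by positivity
    have m1 : 0 ≤ v * (p * h ^ 2) := by positivity
    have m2 : 0 ≤ M * (p * h ^ 2) := by positivity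
    have m3 : 0 ≤ M * (p ^ 2 * h) := by positivity
    have m4 : 0 ≤ v * p ^ 3 := by positivity
    rw [abs_le] at key ⊢
    constructor <;> linarith [key.1, key.2, k1.1, k1.2, k2.1, k2.2]
  · intro h hh p hp
    obtain ⟨hb0, hb1, hb2⟩ := exp_bounds_of_mem_Ioc hh
    obtain ⟨i1, i2, i3, e1, e2, e3⟩ := moments_exp_mul_sub_one hint hmean h2 h3 hh
    have hp0 := hp.1
    have hh0 := hh.1
    set c := v / (2 * v + M) with hc
    have hc0 : 0 < c := by positivity
    have hc1 : c ≤ 1 := by rw [hc, div_le_one (by positivity)]; linarith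
    have key := integral_sqrt_one_add_mul_le i1 i2 i3 (hlow h) hp c
    rw [← hF, e1, e2, ← hv] at key
    have k3 : p ^ 2 / 4 * c ^ 2 * ∫ ω, |Real.exp h * ξ ω - 1| ^ 3 ∂μ ≤ p ^ 2 / 4 * c ^ 2 * M := by
      gcongr
    have hsq : v ≤ Real.exp h ^ 2 * v + (Real.exp h - 1) ^ 2 := by
      have : 1 ≤ Real.exp h ^ 2 := by nlinarith
      nlinarith [sq_nonneg (Real.exp h - 1)]
    have k2 : p ^ 2 / 4 * (2 * c - 2 * c ^ 2) * v ≤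
        p ^ 2 / 4 * (2 * c - 2 * c ^ 2) * (Real.exp h ^ 2 * v + (Real.exp h - 1) ^ 2) := by
      refine mul_le_mul_of_nonneg_left hsq (mul_nonneg (by positivity) ?_)
      nlinarith
    have k1 : p / 2 * (Real.exp h - 1) ≤ p / 2 * (2 * h) := by gcongr
    have hw : 1 / 4 * (v ^ 2 / (2 * v + M)) * p ^ 2 =
        p ^ 2 / 4 * (2 * c - 2 * c ^ 2) * v - p ^ 2 / 4 * c ^ 2 * M := by
      rw [hc]; field_simp; ring
    linarith
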